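/- arXiv:1305.2972 — 3 statements merged into one kernel-verified Lean document; each statement's English description precedes it below -/
import Mathlib

section
/- (Boundary condition for the nested contour integral.) Fix q ∈ (0,1), an integer k ≥ 2, and radii r_1,…,r_k ∈ (0,1) with r_A > q r_B + (1−q) for all 1 ≤ A < B ≤ k. Let g be holomorphic on an open set containing the closed disk {z ∈ ℂ : |z−1| ≤ r_1}. For n⃗ ∈ ℤ^k define m(n⃗) as the iterated integral, over the counterclockwise circles |z_j − 1| = r_j (innermost integral in z_k), of ∏_{1≤A<B≤k} (z_A − z_B)/(z_A − q z_B) · ∏_{j=1}^{k} (1−z_j)^{−n_j} g(z_j) z_j^{−1}; on these circles z_j ≠ 0, z_j ≠ 1 and z_A ≠ q z_B for A < B, so the integrand is well defined. Then for every i ∈ {1,…,k−1} and every n⃗ ∈ ℤ^k with n_i = n_{i+1}: m(n⃗ − e_i) − m(n⃗) − q (m(n⃗ − e_{i+1}) − m(n⃗)) = 0, where e_i denotes the i-th standard basis vector of ℤ^k. -/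
open scoped Real

/-- Iterated contour integral over counterclockwise circles `|z_j - c| = r j`,
with the innermost integral in the last variable. -/
noncomputable def iterInt : (k : ℕ) → ℂ → (Fin k → ℝ) → ((Fin k → ℂ) → ℂ) → ℂ
  | 0, _, _, f => f (fun i => i.elim0)
  | (k + 1), c, r, f =>
      ∮ z in C(c, r 0), iterInt k c (fun j => r j.succ) (fun w => f (Fin.cons z w))

/-- The nested contour integral `m(n⃗)` of Statement 13: the iterated integral over the
circles `|z_j - 1| = r j` of
`∏_{A<B} (z_A - z_B)/(z_A - q z_B) · ∏_j (1 - z_j)^{-n_j} g(z_j) z_j⁻¹`. -/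
noncomputable def m13 (q : ℝ) (k : ℕ) (r : Fin k → ℝ) (g : ℂ → ℂ) (n : Fin k → ℤ) : ℂ :=
  iterInt k 1 r (fun z =>
    (∏ A : Fin k, ∏ B ∈ Finset.Ioi A, (z A - z B) / (z A - (q : ℂ) * z B))
      * ∏ j : Fin k, (1 - z j) ^ (-(n j)) * g (z j) * (z j)⁻¹)

open MeasureTheory Set Function

theorem norm_torusMap_sub {k : ℕ} {c : Fin k → ℂ} {R : Fin k → ℝ} (hR : ∀ j, 0 ≤ R j)
    (θ : Fin k → ℝ) (j : Fin k) : ‖torusMap c R θ j - c j‖ = R j := by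
  simp [torusMap, abs_of_nonneg (hR j)]

theorem torusIntegral_congr {k : ℕ} {f g : (Fin k → ℂ) → ℂ} {c : Fin k → ℂ} {R : Fin k → ℝ}
    (h : ∀ θ, f (torusMap c R θ) = g (torusMap c R θ)) :
    torusIntegral f c R = torusIntegral g c R := by
  simp only [torusIntegral, h]

theorem continuous_torusMap {k : ℕ} (c : Fin k → ℂ) (R : Fin k → ℝ) :
    Continuous (torusMap c R) := by
  unfold torusMap
  fun_prop

theorem Continuous.torusIntegrable {k : ℕ} {f : (Fin k → ℂ) → ℂ} {c : Fin k → ℂ} {R : Fin k → ℝ}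
    (hf : Continuous fun θ => f (torusMap c R θ)) : TorusIntegrable f c R :=
  hf.continuousOn.integrableOn_compact isCompact_Icc

theorem torusMap_cons {k : ℕ} (c : Fin (k + 1) → ℂ) (R : Fin (k + 1) → ℝ) (x : ℝ)
    (θ : Fin k → ℝ) :
    torusMap c R (Fin.cons x θ) = Fin.cons (circleMap (c 0) (R 0) x)
      (torusMap (fun j => c j.succ) (fun j => R j.succ) θ) := by
  ext j
  refine Fin.cases ?_ (fun j => ?_) j <;> simp [torusMap, circleMap]

theorem iterInt_eq_torusIntegral (k : ℕ) (c : ℂ) (r : Fin k → ℝ) (f : (Fin k → ℂ) → ℂ)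
    (hf : Continuous fun θ => f (torusMap (fun _ => c) r θ)) :
    iterInt k c r f = torusIntegral f (fun _ => c) r := by
  induction k with
  | zero =>
    rw [torusIntegral_dim0]
    exact congrArg f (Subsingleton.elim _ _)
  | succ k ih =>
    rw [torusIntegral_succ hf.torusIntegrable]
    simp only [iterInt, circleIntegral]
    congr 1
    ext x
    congr 1
    refine ih _ _ ?_
    have h : Continuous fun θ : Fin k → ℝ => (Fin.cons x θ : Fin (k + 1) → ℝ) := by fun_prop
    simpa only [Function.comp_def, torusMap_cons] using hf.comp h

/-- Recurrent formula for `torusIntegral` with the circle integral innermost. -/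
theorem torusIntegral_succAbove_symm {k : ℕ} {f : (Fin (k + 1) → ℂ) → ℂ} {c : Fin (k + 1) → ℂ}
    {R : Fin (k + 1) → ℝ} (hf : TorusIntegrable f c R) (i : Fin (k + 1)) :
    torusIntegral f c R = torusIntegral
      (fun y => ∮ x in C(c i, R i), f (i.insertNth x y)) (c ∘ i.succAbove) (R ∘ i.succAbove) := by
  set e : ℝ × (Fin k → ℝ) ≃ᵐ (Fin (k + 1) → ℝ) :=
    (MeasurableEquiv.piFinSuccAbove (fun _ => ℝ) i).symm
  have hem : MeasurePreserving e :=
    (volume_preserving_piFinSuccAbove (fun _ : Fin (k + 1) => ℝ) i).symm _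
  have heπ : (e ⁻¹' Icc 0 fun _ => 2 * π) = Icc 0 (2 * π) ×ˢ Icc (0 : Fin k → ℝ) fun _ => 2 * π :=
    ((Fin.insertNthOrderIso (fun _ => ℝ) i).preimage_Icc _ _).trans (Icc_prod_eq _ _)
  have hint := hf.function_integrable
  rw [← hem.integrableOn_comp_preimage e.measurableEmbedding, heπ, IntegrableOn,
    Measure.volume_eq_prod, ← Measure.prod_restrict, Function.comp_def] at hint
  rw [torusIntegral, ← hem.map_eq, setIntegral_map_equiv, heπ, Measure.volume_eq_prod,
    ← Measure.prod_restrict, integral_prod_symm _ hint, torusIntegral]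
  refine setIntegral_congr_fun measurableSet_Icc fun Θ _ => ?_
  simp only [circleIntegral_def_Icc, ← integral_smul]
  refine setIntegral_congr_fun measurableSet_Icc fun θ _ => ?_
  have h0 : e (θ, Θ) = i.insertNth θ Θ := rfl
  have h1 : torusMap c R (i.insertNth θ Θ) = i.insertNth (circleMap (c i) (R i) θ)
      (torusMap (c ∘ i.succAbove) (R ∘ i.succAbove) Θ) := by
    ext j
    refine i.succAboveCases ?_ (fun j => ?_) j <;> simp [torusMap, circleMap]
  simp only [h0, h1, deriv_circleMap, i.prod_univ_succAbove _, smul_smul, circleMap_zero,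
    Fin.insertNth_apply_same, Fin.insertNth_apply_succAbove, Function.comp_apply]
  congr 1
  ring

/-- Deformation of one radius of a torus across a region of holomorphy. -/
theorem torusIntegral_update_radius {k : ℕ} {f : (Fin k → ℂ) → ℂ} {c : Fin k → ℂ}
    {R : Fin k → ℝ} (hR : ∀ j, 0 ≤ R j) {a : Fin k} {ρ : ℝ} (h0 : 0 < ρ) (hle : ρ ≤ R a)
    (hf : ∀ z, (∀ j, j ≠ a → ‖z j - c j‖ = R j) → ρ ≤ ‖z a - c a‖ → ‖z a - c a‖ ≤ R a →
      DifferentiableAt ℂ f z) :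
    torusIntegral f c R = torusIntegral f c (update R a ρ) := by
  obtain _ | k := k
  · exact a.elim0
  have hR' : ∀ j, 0 ≤ update R a ρ j := by
    intro j
    rcases eq_or_ne j a with rfl | hj
    · simpa using h0.le
    · simpa [hj] using hR j
  have hc : Continuous fun θ => f (torusMap c R θ) := by
    refine continuous_iff_continuousAt.2 fun θ => ContinuousAt.comp (g := f) ?_
      (continuous_torusMap c R).continuousAt
    have h := norm_torusMap_sub (c := c) hR θ
    exact (hf _ (fun j _ => h j) (hle.trans (h a).ge) (h a).le).continuousAt
  have hc' : Continuous fun θ => f (torusMap c (update R a ρ) θ) := by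
    refine continuous_iff_continuousAt.2 fun θ => ContinuousAt.comp (g := f) ?_
      (continuous_torusMap c _).continuousAt
    have h := norm_torusMap_sub (c := c) hR' θ
    have ha := h a
    rw [update_self] at ha
    exact (hf _ (fun j hj => by rw [h j, update_of_ne hj]) ha.ge (ha.trans_le hle)).continuousAt
  rw [torusIntegral_succAbove_symm hc.torusIntegrable a,
    torusIntegral_succAbove_symm hc'.torusIntegrable a]
  have hcomp : update R a ρ ∘ a.succAbove = R ∘ a.succAbove := by
    ext j
    simp
  rw [hcomp, update_self]
  refine torusIntegral_congr fun Θ => ?_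
  have hd : ∀ x, ρ ≤ ‖x - c a‖ → ‖x - c a‖ ≤ R a → DifferentiableAt ℂ
      (fun x => f (a.insertNth x (torusMap (c ∘ a.succAbove) (R ∘ a.succAbove) Θ))) x := by
    intro x hx hx'
    refine DifferentiableAt.comp (g := f) x (hf _ ?_ (by simpa using hx) (by simpa using hx')) ?_
    · intro j
      refine a.succAboveCases (by simp) (fun j _ => ?_) j
      rw [Fin.insertNth_apply_succAbove]
      exact norm_torusMap_sub (c := c ∘ a.succAbove) (R := R ∘ a.succAbove) (fun j => hR _) Θ j
    · refine differentiableAt_pi.2 fun j => ?_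
      refine a.succAboveCases ?_ (fun j => ?_) j <;> simp
  refine Complex.circleIntegral_eq_of_differentiable_on_annulus_off_countable h0 hle
    countable_empty (fun x hx => (hd x ?_ ?_).continuousAt.continuousWithinAt)
    (fun x hx => hd x ?_ ?_)
  all_goals
    simp only [mem_sdiff, Metric.mem_closedBall, Metric.mem_ball, dist_eq_norm, not_lt, not_le,
      mem_empty_iff_false, not_false_iff, and_true] at hx
    linarith [hx.1, hx.2]

theorem torusIntegral_comp_perm {k : ℕ} (f : (Fin k → ℂ) → ℂ) (c : Fin k → ℂ) (R : Fin k → ℝ)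
    (σ : Equiv.Perm (Fin k)) (hc : c ∘ σ = c) (hR : R ∘ σ = R) :
    torusIntegral (fun z => f (z ∘ σ)) c R = torusIntegral f c R := by
  set e : (Fin k → ℝ) ≃ᵐ (Fin k → ℝ) := MeasurableEquiv.arrowCongr' σ.symm (MeasurableEquiv.refl ℝ)
  have hem : MeasurePreserving e := volume_preserving_arrowCongr' _ _ (.id _)
  have he : ∀ θ, e θ = θ ∘ σ := fun θ => rfl
  have heπ : (e ⁻¹' Icc 0 fun _ => 2 * π) = Icc (0 : Fin k → ℝ) fun _ => 2 * π := by
    ext θ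
    simp only [mem_preimage, mem_Icc, Pi.le_def, he, Function.comp_apply, Pi.zero_apply]
    exact and_congr (σ.forall_congr_left (p := fun i => 0 ≤ θ (σ i)) |>.trans (by simp))
      (σ.forall_congr_left (p := fun i => θ (σ i) ≤ 2 * π) |>.trans (by simp))
  rw [torusIntegral, torusIntegral]
  conv_rhs => rw [← hem.map_eq, setIntegral_map_equiv, heπ]
  refine setIntegral_congr_fun measurableSet_Icc fun θ _ => ?_
  have hRσ : ∀ i, R (σ i) = R i := congrFun hR
  have hcσ : ∀ i, c (σ i) = c i := congrFun hc
  have h1 : torusMap c R θ ∘ σ = torusMap c R (θ ∘ σ) := by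
    ext i
    simp [torusMap, hRσ, hcσ]
  have h2 : ∏ i, ((R i : ℂ) * Complex.exp ((θ ∘ σ) i * Complex.I) * Complex.I) =
      ∏ i, ((R i : ℂ) * Complex.exp (θ i * Complex.I) * Complex.I) := by
    rw [← Equiv.prod_comp σ fun i => (R i : ℂ) * Complex.exp (θ i * Complex.I) * Complex.I]
    simp [hRσ]
  simp only [h1, he, h2]

/-- The integrand of `m13` with the cross terms restricted to a set `s` of pairs. -/
noncomputable def crossIntegrand {k : ℕ} (q : ℝ) (g : ℂ → ℂ) (s : Finset (Fin k × Fin k))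
    (n : Fin k → ℤ) (z : Fin k → ℂ) : ℂ :=
  (∏ p ∈ s, (z p.1 - z p.2) / (z p.1 - (q : ℂ) * z p.2))
    * ∏ j : Fin k, (1 - z j) ^ (-(n j)) * g (z j) * (z j)⁻¹

/-- The pairs `A < B`. -/
def ltPairs (k : ℕ) : Finset (Fin k × Fin k) := Finset.univ.filter fun p => p.1 < p.2

theorem m13_eq_iterInt_crossIntegrand (q : ℝ) (k : ℕ) (r : Fin k → ℝ) (g : ℂ → ℂ)
    (n : Fin k → ℤ) : m13 q k r g n = iterInt k 1 r (crossIntegrand q g (ltPairs k) n) := by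
  unfold m13 crossIntegrand ltPairs
  congr 1
  ext z
  rw [Finset.prod_filter, Fintype.prod_prod_type]
  congr 2
  ext A
  rw [← Finset.prod_filter, ← Finset.filter_lt_eq_Ioi]

theorem differentiableAt_crossIntegrand {k : ℕ} {q : ℝ} {g : ℂ → ℂ} {s : Finset (Fin k × Fin k)}
    {n : Fin k → ℤ} {z : Fin k → ℂ} (hs : ∀ p ∈ s, z p.1 - (q : ℂ) * z p.2 ≠ 0)
    (h1 : ∀ j, 1 - z j ≠ 0) (h0 : ∀ j, z j ≠ 0) (hg : ∀ j, DifferentiableAt ℂ g (z j)) :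
    DifferentiableAt ℂ (crossIntegrand q g s n) z := by
  have hz : ∀ j, DifferentiableAt ℂ (fun z : Fin k → ℂ => z j) z := fun j => by fun_prop
  unfold crossIntegrand
  refine DifferentiableAt.mul
    (HasFDerivAt.finsetProd fun p hp => DifferentiableAt.hasFDerivAt ?_).differentiableAt
    (HasFDerivAt.finsetProd fun p _ => DifferentiableAt.hasFDerivAt ?_).differentiableAt
  · simp only [div_eq_mul_inv]
    exact ((hz _).fun_sub (hz _)).mul (((hz _).fun_sub ((hz _).const_mul _)).inv (hs p hp))
  · exact ((((hz p).const_sub 1).zpow (.inl (h1 p))).mul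
      (DifferentiableAt.comp (g := g) z (hg p) (hz p))).mul ((hz p).inv (h0 p))

theorem sub_mul_ne_zero_of_norm {q x y : ℝ} (hq : q ∈ Ioo (0 : ℝ) 1) {v w : ℂ}
    (hv : x ≤ ‖v - 1‖) (hw : ‖w - 1‖ ≤ y) (h : q * y + (1 - q) < x) : v - (q : ℂ) * w ≠ 0 := by
  intro hvw
  have hv' : v - 1 = (q : ℂ) * (w - 1) - ((1 - q : ℝ) : ℂ) := by
    push_cast
    linear_combination hvw
  have : ‖v - 1‖ ≤ q * ‖w - 1‖ + (1 - q) := by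
    rw [hv']
    refine (norm_sub_le _ _).trans ?_
    rw [norm_mul, Complex.norm_real, Complex.norm_real, Real.norm_of_nonneg hq.1.le,
      Real.norm_of_nonneg (by linarith [hq.2])]
  nlinarith [hq.1]

theorem crossIntegrand_update {k : ℕ} (q : ℝ) (g : ℂ → ℂ) (s : Finset (Fin k × Fin k))
    (n : Fin k → ℤ) (a : Fin k) {z : Fin k → ℂ} (hz : 1 - z a ≠ 0) :
    crossIntegrand q g s (update n a (n a - 1)) z = (1 - z a) * crossIntegrand q g s n z := by
  unfold crossIntegrand
  rw [mul_left_comm]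
  congr 1
  rw [← Finset.mul_prod_erase _ _ (Finset.mem_univ a),
    ← Finset.mul_prod_erase (a := a) _ (fun j => (1 - z j) ^ (-(n j)) * g (z j) * (z j)⁻¹)
      (Finset.mem_univ a), ← mul_assoc]
  congr 1
  · rw [update_self, neg_sub, sub_eq_add_neg 1 (n a), zpow_one_add₀ hz]
    ring
  · refine Finset.prod_congr rfl fun j hj => ?_
    rw [update_of_ne (Finset.ne_of_mem_erase hj)]

theorem crossIntegrand_comp_swap {k : ℕ} (q : ℝ) (g : ℂ → ℂ) {n : Fin k → ℤ} {a b : Fin k}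
    (hab : (b : ℕ) = a + 1) (hn : n a = n b) (z : Fin k → ℂ) :
    crossIntegrand q g ((ltPairs k).erase (a, b)) n (z ∘ Equiv.swap a b) =
      crossIntegrand q g ((ltPairs k).erase (a, b)) n z := by
  set σ := Equiv.swap a b
  have hnσ : ∀ j, n (σ j) = n j := fun j => by
    simp only [σ, Equiv.swap_apply_def]
    split_ifs with h h <;> simp_all
  unfold crossIntegrand
  congr 1
  · refine Finset.prod_equiv (Equiv.prodCongr σ σ) ?_ (fun p _ => rfl)
    rintro ⟨A, B⟩
    simp only [σ, ltPairs, Finset.mem_erase, Finset.mem_filter, Finset.mem_univ, true_and, ne_eq,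
      Prod.mk.injEq, Equiv.prodCongr_apply, Prod.map_apply, Equiv.swap_apply_def, Fin.ext_iff,
      Fin.lt_def]
    split_ifs <;> omega
  · rw [← Equiv.prod_comp σ fun j => (1 - z j) ^ (-(n j)) * g (z j) * (z j)⁻¹]
    simp [hnσ]

theorem m13_boundary {q : ℝ} (hq : q ∈ Ioo (0 : ℝ) 1) {k : ℕ} {r : Fin k → ℝ}
    (hr : ∀ j, r j ∈ Ioo (0 : ℝ) 1) (hnest : ∀ A B : Fin k, A < B → q * r B + (1 - q) < r A)
    {g : ℂ → ℂ} (hg : ∀ j w, ‖w - 1‖ ≤ r j → DifferentiableAt ℂ g w) {a b : Fin k}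
    (hab : (b : ℕ) = a + 1) {n : Fin k → ℤ} (hn : n a = n b) :
    (m13 q k r g (update n a (n a - 1)) - m13 q k r g n)
      - (q : ℂ) * (m13 q k r g (update n b (n b - 1)) - m13 q k r g n) = 0 := by
  have hlt : a < b := Fin.lt_def.2 (by omega)
  have hne : a ≠ b := hlt.ne
  have hba : r b ≤ r a := by
    have := hnest a b hlt
    nlinarith [hq.2, (hr b).2]
  have hr0 : ∀ j, 0 ≤ r j := fun j => (hr j).1.le
  have hz1 : ∀ {w : ℂ}, 0 < ‖w - 1‖ → 1 - w ≠ 0 := fun h => by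
    rw [norm_pos_iff] at h
    rwa [← neg_sub, neg_ne_zero]
  have hz0 : ∀ {w : ℂ}, ‖w - 1‖ < 1 → w ≠ 0 := by
    rintro w h rfl
    simp at h
  have hdiff : ∀ (n : Fin k → ℤ) z, (∀ j, ‖z j - 1‖ = r j) →
      DifferentiableAt ℂ (crossIntegrand q g (ltPairs k) n) z := fun n z hz => by
    refine differentiableAt_crossIntegrand (fun p hp => ?_)
      (fun j => hz1 ((hz j).symm ▸ (hr j).1)) (fun j => hz0 ((hz j).symm ▸ (hr j).2))
      (fun j => hg j _ (hz j).le)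
    exact sub_mul_ne_zero_of_norm hq (hz _).ge (hz _).le
      (hnest _ _ (by simpa [ltPairs] using hp))
  have hnorm : ∀ θ j, ‖torusMap (fun _ => 1) r θ j - 1‖ = r j := fun θ j =>
    norm_torusMap_sub (c := fun _ => 1) hr0 θ j
  have hcont : ∀ n, Continuous fun θ =>
      crossIntegrand q g (ltPairs k) n (torusMap (fun _ => 1) r θ) := fun n =>
    continuous_iff_continuousAt.2 fun θ => ContinuousAt.comp
      (hdiff n _ (hnorm θ)).continuousAt (continuous_torusMap _ r).continuousAt
  have hm : ∀ n, m13 q k r g n =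
      torusIntegral (crossIntegrand q g (ltPairs k) n) (fun _ => 1) r := fun n => by
    rw [m13_eq_iterInt_crossIntegrand, iterInt_eq_torusIntegral _ _ _ _ (hcont n)]
  set s := (ltPairs k).erase (a, b) with hs
  set G : (Fin k → ℂ) → ℂ := fun z => (z a - z b) * crossIntegrand q g s n z with hG
  have hcombine : (m13 q k r g (update n a (n a - 1)) - m13 q k r g n)
      - (q : ℂ) * (m13 q k r g (update n b (n b - 1)) - m13 q k r g n) =
      -torusIntegral G (fun _ => 1) r := by
    have hti := fun n => (hcont n).torusIntegrable
    have hsub : ∀ n', TorusIntegrable (fun z => crossIntegrand q g (ltPairs k) n' z -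
        crossIntegrand q g (ltPairs k) n z) (fun _ => 1) r := fun n' => (hti n').sub (hti n)
    have hmul : TorusIntegrable (fun z => (q : ℂ) * (crossIntegrand q g (ltPairs k)
        (update n b (n b - 1)) z - crossIntegrand q g (ltPairs k) n z)) (fun _ => 1) r :=
      (hsub _).const_mul (q : ℂ)
    simp only [hm]
    rw [← torusIntegral_sub (hti _) (hti _), ← torusIntegral_sub (hti _) (hti _),
      ← torusIntegral_const_mul, ← torusIntegral_sub (hsub _) hmul, ← torusIntegral_neg]
    refine torusIntegral_congr fun θ => ?_
    have hz := hnorm θ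
    set z := torusMap (fun _ => 1) r θ
    have hz1' : ∀ j, 1 - z j ≠ 0 := fun j => hz1 ((hz j).symm ▸ (hr j).1)
    have hd : z a - (q : ℂ) * z b ≠ 0 :=
      sub_mul_ne_zero_of_norm hq (hz _).ge (hz _).le (hnest _ _ hlt)
    have hfull : crossIntegrand q g (ltPairs k) n z =
        (z a - z b) / (z a - (q : ℂ) * z b) * crossIntegrand q g s n z := by
      unfold crossIntegrand
      rw [← mul_assoc, hs, Finset.mul_prod_erase (ltPairs k)
        (fun p => (z p.1 - z p.2) / (z p.1 - (q : ℂ) * z p.2))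
        (a := (a, b)) (by simpa [ltPairs] using hlt)]
    rw [crossIntegrand_update _ _ _ _ _ (hz1' a), crossIntegrand_update _ _ _ _ _ (hz1' b), hfull]
    linear_combination -crossIntegrand q g s n z * div_mul_cancel₀ (z a - z b) hd
  have hdeform : torusIntegral G (fun _ => 1) r =
      torusIntegral G (fun _ => 1) (update r a (r b)) := by
    refine torusIntegral_update_radius hr0 (hr b).1 hba fun z hz hzb hza => ?_
    have hle : ∀ j, ‖z j - 1‖ ≤ r j := fun j => by
      rcases eq_or_ne j a with rfl | hj
      exacts [hza, (hz j hj).le]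
    have hpos : ∀ j, 0 < ‖z j - 1‖ := fun j => by
      rcases eq_or_ne j a with rfl | hj
      exacts [(hr b).1.trans_le hzb, (hz j hj).symm ▸ (hr j).1]
    refine DifferentiableAt.mul (by fun_prop) (differentiableAt_crossIntegrand ?_
      (fun j => hz1 (hpos j)) (fun j => hz0 ((hle j).trans_lt (hr j).2))
      (fun j => hg j _ (hle j)))
    rintro ⟨A, B⟩ hp
    simp only [hs, ltPairs, Finset.mem_erase, Finset.mem_filter, Finset.mem_univ, true_and,
      ne_eq, Prod.mk.injEq] at hp
    rcases eq_or_ne A a with rfl | hA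
    · refine sub_mul_ne_zero_of_norm hq hzb (hle B) (hnest b B ?_)
      simp only [Fin.ext_iff, Fin.lt_def, true_and] at hp ⊢
      omega
    · exact sub_mul_ne_zero_of_norm hq (hz A hA).ge (hle B) (hnest A B hp.2)
  have hanti : torusIntegral G (fun _ => 1) (update r a (r b)) =
      -torusIntegral G (fun _ => 1) (update r a (r b)) := by
    conv_lhs => rw [← torusIntegral_comp_perm G (fun _ => 1) (update r a (r b)) (Equiv.swap a b)
      rfl (by
        ext j
        simp only [Function.comp_apply, Equiv.swap_apply_def]
        split_ifs with h h' <;> simp_all [hne.symm])]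
    rw [← torusIntegral_neg]
    refine torusIntegral_congr fun θ => ?_
    simp only [hG, hs, crossIntegrand_comp_swap q g hab hn, Function.comp_apply,
      Equiv.swap_apply_left, Equiv.swap_apply_right]
    ring
  rw [hcombine, hdeform, neg_eq_zero]
  exact self_eq_neg.1 hanti

theorem stmt_13 (q : ℝ) (hq : q ∈ Set.Ioo (0:ℝ) 1) (k : ℕ) (hk : 2 ≤ k)
    (r : Fin k → ℝ) (hr : ∀ j, r j ∈ Set.Ioo (0:ℝ) 1)
    (hnest : ∀ A B : Fin k, A < B → q * r B + (1 - q) < r A)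
    (g : ℂ → ℂ) (U : Set ℂ) (hU : IsOpen U)
    (hUball : Metric.closedBall (1 : ℂ) (r ⟨0, by omega⟩) ⊆ U)
    (hg : DifferentiableOn ℂ g U)
    (i : ℕ) (hi : i + 1 < k) (n : Fin k → ℤ)
    (hn : n ⟨i, by omega⟩ = n ⟨i + 1, hi⟩) :
    (m13 q k r g (Function.update n ⟨i, by omega⟩ (n ⟨i, by omega⟩ - 1)) - m13 q k r g n)
      - (q : ℂ) * (m13 q k r g (Function.update n ⟨i + 1, hi⟩ (n ⟨i + 1, hi⟩ - 1))
          - m13 q k r g n) = 0 := by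
  refine m13_boundary hq hr hnest (fun j w hw => ?_) rfl hn
  have hj : r j ≤ r ⟨0, by omega⟩ := by
    rcases Nat.eq_zero_or_pos j with h | h
    · exact (congrArg r (Fin.ext h)).le
    · have := hnest ⟨0, by omega⟩ j h
      nlinarith [hq.2, (hr j).2]
  exact hg.differentiableAt (hU.mem_nhds (hUball (mem_closedBall_iff_norm.2 (hw.trans hj))))
end

section
/- (Initial data evaluation of the nested contour integral.) Fix q ∈ (0,1), an integer k ≥ 1, and radii r_1,…,r_k ∈ (0,1) with r_A > q r_B + (1−q) for all 1 ≤ A < B ≤ k. Then for all integers n_1 ≥ n_2 ≥ ⋯ ≥ n_k ≥ 1: ((−1)^k q^{k(k−1)/2} / (2πι)^k) times the iterated integral, over the counterclockwise circles |z_j − 1| = r_j (innermost integral in z_k), of ∏_{1≤A<B≤k} (z_A − z_B)/(z_A − q z_B) · ∏_{j=1}^{k} (1−z_j)^{−n_j} z_j^{−1}, equals 1. -/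
open scoped Real

open Filter Topology Metric Bornology

/-- Cauchy's integral formula for the exterior of a disc, for functions vanishing at infinity. -/
theorem circleIntegral_sub_inv_mul_of_differentiableOn_exterior {c a : ℂ} {R : ℝ} (hR : 0 < R)
    (ha : R < ‖a - c‖) {g : ℂ → ℂ} (hg : DifferentiableOn ℂ g (ball c R)ᶜ)
    (hlim : Tendsto g (cobounded ℂ) (𝓝 0)) :
    (∮ z in C(c, R), (z - a)⁻¹ * g z) = -(2 * π * Complex.I * g a) := by
  have hnhds : (ball c R)ᶜ ∈ 𝓝 a := by
    refine mem_of_superset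
      (isClosed_closedBall.isOpen_compl.mem_nhds (x := a) (s := (closedBall c R)ᶜ) ?_)
      (Set.compl_subset_compl.2 ball_subset_closedBall)
    simpa [dist_eq_norm] using ha
  have hd : DifferentiableOn ℂ (dslope g a) (ball c R)ᶜ :=
    (Complex.differentiableOn_dslope hnhds).2 hg
  have split : ∀ M, R ≤ M → M ≠ ‖a - c‖ →
      (∮ z in C(c, M), (z - a)⁻¹ * g z) =
        (∮ z in C(c, M), dslope g a z) + g a * ∮ z in C(c, M), (z - a)⁻¹ := by
    intro M hM hne
    have hM0 : 0 ≤ M := hR.le.trans hM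
    have hsub : sphere c M ⊆ (ball c R)ᶜ := by
      intro z hz
      simp only [mem_sphere] at hz
      simpa [hz] using hM
    have hza : ∀ z ∈ sphere c M, z - a ≠ 0 := by
      intro z hz h
      rw [sub_eq_zero] at h
      subst h
      exact hne (by simpa [dist_eq_norm] using hz.symm)
    rw [← circleIntegral.integral_const_mul, ← circleIntegral.integral_add]
    · refine circleIntegral.integral_congr hM0 fun z hz => ?_
      have := hza z hz
      simp only [dslope_of_ne g (sub_ne_zero.1 this), slope_def_field]
      field_simp
      ring
    · exact (hd.continuousOn.mono hsub).circleIntegrable hM0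
    · refine ContinuousOn.circleIntegrable hM0 ?_
      exact continuousOn_const.mul ((continuousOn_id.sub continuousOn_const).inv₀ hza)
  have hsmall : (∮ z in C(c, R), (z - a)⁻¹) = 0 := by
    have hza : ∀ z ∈ closedBall c R, z - a ≠ 0 := by
      intro z hz h
      rw [sub_eq_zero] at h
      subst h
      rw [mem_closedBall, dist_eq_norm] at hz
      exact absurd hz (not_le.2 ha)
    refine Complex.circleIntegral_eq_zero_of_differentiable_on_off_countable hR.le
      Set.countable_empty ?_ fun z hz => ?_
    · exact (continuousOn_id.sub continuousOn_const).inv₀ hza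
    · exact (differentiableAt_id.sub_const a).inv (hza z (ball_subset_closedBall hz.1))
  have hlarge : ∀ M, ‖a - c‖ < M →
      (∮ z in C(c, M), (z - a)⁻¹ * g z) =
        (∮ z in C(c, R), (z - a)⁻¹ * g z) + 2 * π * Complex.I * g a := by
    intro M hM
    rw [split M (ha.trans hM).le hM.ne', split R le_rfl ha.ne, hsmall,
      circleIntegral.integral_sub_inv_of_mem_ball (by simpa [dist_eq_norm] using hM),
      Complex.circleIntegral_eq_of_differentiable_on_annulus_off_countable hR (ha.trans hM).le
        Set.countable_empty (hd.continuousOn.mono fun z hz => hz.2)]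
    · ring
    · intro z hz
      refine (hd z ?_).differentiableAt ?_
      · exact fun h => hz.1.2 (ball_subset_closedBall h)
      · exact mem_of_superset (isClosed_closedBall.isOpen_compl.mem_nhds hz.1.2)
          (Set.compl_subset_compl.2 ball_subset_closedBall)
  rw [← add_eq_zero_iff_eq_neg, ← norm_le_zero_iff]
  refine le_of_forall_pos_le_add fun ε hε => ?_
  have hpos : 0 < ‖a - c‖ := hR.trans ha
  have hδ : 0 < ε / (4 * π) := by positivity
  obtain ⟨N, -, hN⟩ := (hasBasis_cobounded_compl_closedBall c).eventually_iff.1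
    (hlim.eventually (ball_mem_nhds 0 hδ))
  set M := max (N + 1) (2 * ‖a - c‖)
  have hM1 : N < M := (lt_add_one N).trans_le (le_max_left _ _)
  have hM2 : 2 * ‖a - c‖ ≤ M := le_max_right _ _
  have hM0 : 0 < M := by linarith
  rw [← hlarge M (by linarith)]
  refine (circleIntegral.norm_integral_le_of_norm_le_const hM0.le
    (C := (M / 2)⁻¹ * (ε / (4 * π))) fun z hz => ?_).trans (le_of_eq ?_)
  · have hzM : ‖z - c‖ = M := by simpa [dist_eq_norm] using hz
    rw [norm_mul, norm_inv]
    gcongr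
    · have := norm_sub_norm_le (z - c) (a - c)
      rw [sub_sub_sub_cancel_right] at this
      linarith
    · have := hN (x := z) (by simpa [dist_eq_norm, hzM] using hM1)
      simpa using this.le
  · field_simp
    ring

theorem continuous_iterInt {X : Type*} [TopologicalSpace X] {k : ℕ} {c : ℂ} {r : Fin k → ℝ}
    {f : X → (Fin k → ℂ) → ℂ}
    (hf : Continuous fun p : X × (Fin k → ℝ) => f p.1 fun i => circleMap c (r i) (p.2 i)) :
    Continuous fun x => iterInt k c r (f x) := by
  induction k generalizing X with
  | zero =>
    have : Continuous fun x : X => (x, (fun i => i.elim0 : Fin 0 → ℝ)) := by fun_prop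
    refine (hf.comp this).congr fun x => ?_
    simp only [Function.comp, iterInt]
    congr 1
    exact Subsingleton.elim _ _
  | succ k ih =>
    simp only [iterInt, circleIntegral]
    refine intervalIntegral.continuous_parametric_intervalIntegral_of_continuous' ?_ _ _
    simp only [Function.uncurry_def, deriv_circleMap, smul_eq_mul]
    refine Continuous.mul (by fun_prop) ?_
    refine ih (X := X × ℝ) (f := fun p w => f p.1 (Fin.cons (circleMap c (r 0) p.2) w)) ?_
    have hc : Continuous fun p : (X × ℝ) × (Fin k → ℝ) =>
        (p.1.1, (Fin.cons p.1.2 p.2 : Fin (k + 1) → ℝ)) := by fun_prop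
    refine (hf.comp hc).congr fun p => ?_
    simp only [Function.comp]
    congr 1
    ext i
    refine Fin.cases ?_ (fun j => ?_) i <;> simp

theorem iterInt_congr {k : ℕ} {c : ℂ} {r : Fin k → ℝ} {f g : (Fin k → ℂ) → ℂ}
    (hr : ∀ i, 0 ≤ r i) (h : ∀ w, (∀ i, w i ∈ sphere c (r i)) → f w = g w) :
    iterInt k c r f = iterInt k c r g := by
  induction k with
  | zero => exact h _ fun i => i.elim0
  | succ k ih =>
    refine circleIntegral.integral_congr (hr 0) fun z hz => ?_
    refine ih (fun i => hr _) fun w hw => h _ fun i => ?_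
    refine Fin.cases ?_ (fun j => ?_) i
    · simpa using hz
    · simpa using hw j

theorem iterInt_const_mul (k : ℕ) (c : ℂ) (r : Fin k → ℝ) (a : ℂ) (f : (Fin k → ℂ) → ℂ) :
    iterInt k c r (fun w => a * f w) = a * iterInt k c r f := by
  induction k with
  | zero => rfl
  | succ k ih => simp only [iterInt, ih, circleIntegral.integral_const_mul]

theorem circleIntegral_circleIntegral_swap {c d : ℂ} {R S : ℝ} {f : ℂ → ℂ → ℂ}
    (hf : Continuous fun p : ℝ × ℝ => f (circleMap c R p.1) (circleMap d S p.2)) :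
    (∮ z in C(c, R), ∮ w in C(d, S), f z w) = ∮ w in C(d, S), ∮ z in C(c, R), f z w := by
  simp only [circleIntegral, ← intervalIntegral.integral_smul]
  rw [MeasureTheory.intervalIntegral_intervalIntegral_swap]
  · simp only [smul_smul, mul_comm]
  · have : Continuous (Function.uncurry fun θ η : ℝ => deriv (circleMap c R) θ •
        deriv (circleMap d S) η • f (circleMap c R θ) (circleMap d S η)) := by
      simp only [Function.uncurry_def, deriv_circleMap, smul_eq_mul]
      exact Continuous.mul (by fun_prop) (Continuous.mul (by fun_prop) hf)
    refine (this.continuousOn.integrableOn_compact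
      (isCompact_uIcc.prod isCompact_uIcc)).mono_set
        (Set.prod_mono Set.uIoc_subset_uIcc Set.uIoc_subset_uIcc)

theorem circleIntegral_iterInt_swap {k : ℕ} {c d : ℂ} {R : ℝ} {r : Fin k → ℝ}
    (hr : ∀ i, 0 ≤ r i) {f : ℂ → (Fin k → ℂ) → ℂ}
    (hf : Continuous fun p : ℝ × (Fin k → ℝ) =>
      f (circleMap d R p.1) fun i => circleMap c (r i) (p.2 i)) :
    (∮ z in C(d, R), iterInt k c r (f z)) = iterInt k c r fun w => ∮ z in C(d, R), f z w := by
  induction k with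
  | zero => rfl
  | succ k ih =>
    simp only [iterInt]
    rw [circleIntegral_circleIntegral_swap]
    · refine circleIntegral.integral_congr (hr 0) fun z hz => ?_
      rw [← abs_of_nonneg (hr 0), ← range_circleMap] at hz
      obtain ⟨θ, rfl⟩ := hz
      refine ih (fun i => hr _) ?_
      have hc : Continuous fun p : ℝ × (Fin k → ℝ) =>
          (p.1, (Fin.cons θ p.2 : Fin (k + 1) → ℝ)) := by fun_prop
      refine (hf.comp hc).congr fun p => ?_
      simp only [Function.comp]
      congr 1
      ext i
      refine Fin.cases ?_ (fun j => ?_) i <;> simp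
    · refine continuous_iterInt (X := ℝ × ℝ) (f := fun p w =>
        f (circleMap d R p.1) (Fin.cons (circleMap c (r 0) p.2) w)) ?_
      have hc : Continuous fun p : (ℝ × ℝ) × (Fin k → ℝ) =>
          (p.1.1, (Fin.cons p.1.2 p.2 : Fin (k + 1) → ℝ)) := by fun_prop
      refine (hf.comp hc).congr fun p => ?_
      simp only [Function.comp]
      congr 1
      ext i
      refine Fin.cases ?_ (fun j => ?_) i <;> simp

theorem norm_mul_sub_one_le {q : ℝ} (hq : q ∈ Set.Ioo (0 : ℝ) 1) (w : ℂ) :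
    ‖(q : ℂ) * w - 1‖ ≤ q * ‖w - 1‖ + (1 - q) := by
  have h : (q : ℂ) * w - 1 = q * (w - 1) + ((q - 1 : ℝ) : ℂ) := by push_cast; ring
  rw [h]
  refine (norm_add_le _ _).trans (le_of_eq ?_)
  rw [norm_mul, Complex.norm_real, Complex.norm_real, Real.norm_of_nonneg hq.1.le,
    Real.norm_of_nonpos (by linarith [hq.2])]
  ring

theorem ne_zero_of_norm_sub_one_lt {z : ℂ} (h : ‖z - 1‖ < 1) : z ≠ 0 := by
  rintro rfl
  simp at h

theorem tendsto_sub_div_sub_cobounded (a b : ℂ) :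
    Tendsto (fun z : ℂ => (z - a) / (z - b)) (cobounded ℂ) (𝓝 1) := by
  have h : Tendsto (fun z : ℂ => 1 + (b - a) * (z - b)⁻¹) (cobounded ℂ) (𝓝 (1 + (b - a) * 0)) :=
    ((tendsto_inv₀_cobounded.comp (tendsto_sub_const_cobounded b)).const_mul _).const_add _
  rw [mul_zero, add_zero] at h
  refine h.congr' ?_
  filter_upwards [eventually_ne_cobounded b] with z hz
  have := sub_ne_zero.2 hz
  field_simp
  ring

/-- Residue evaluation of a single contour integral: the only pole outside the contour is `0`. -/
theorem circleIntegral_prod_div_mul_zpow {k : ℕ} {q R : ℝ} (hq : q ≠ 0) (hR : R ∈ Set.Ioo (0 : ℝ) 1)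
    {w : Fin k → ℂ} (hw : ∀ i, ‖(q : ℂ) * w i - 1‖ < R) (hw0 : ∀ i, w i ≠ 0) {n : ℤ} (hn : 1 ≤ n) :
    (∮ z in C(1, R), (∏ i, (z - w i) / (z - q * w i)) * ((1 - z) ^ (-n) * z⁻¹)) =
      -(2 * π * Complex.I * ((q : ℂ) ^ k)⁻¹) := by
  have hq' : (q : ℂ) ≠ 0 := by exact_mod_cast hq
  set g : ℂ → ℂ := fun z => (∏ i, (z - w i) / (z - q * w i)) * (1 - z) ^ (-n) with hgdef
  have hg0 : g 0 = ((q : ℂ) ^ k)⁻¹ := by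
    have : ∀ i, (0 - w i) / (0 - q * w i) = (q : ℂ)⁻¹ := fun i => by
      have := hw0 i
      rw [zero_sub, zero_sub, neg_div_neg_eq]
      field_simp
    simp only [hgdef, this]
    simp
  have hdiff : DifferentiableOn ℂ g (ball 1 R)ᶜ := by
    intro z hz
    have hz' : R ≤ ‖z - 1‖ := by simpa [dist_eq_norm] using hz
    refine DifferentiableAt.differentiableWithinAt (DifferentiableAt.mul ?_ ?_)
    · refine DifferentiableAt.fun_finsetProd fun i _ => ?_
      refine DifferentiableAt.div (by fun_prop) (by fun_prop) fun h => ?_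
      rw [sub_eq_zero] at h
      rw [h] at hz'
      exact absurd (hw i) (not_lt.2 hz')
    · refine DifferentiableAt.zpow (by fun_prop) (Or.inl fun h => ?_)
      rw [norm_sub_rev, h, norm_zero] at hz'
      exact absurd hR.1 (not_lt.2 hz')
  have hlim : Tendsto g (cobounded ℂ) (𝓝 0) := by
    obtain ⟨m, rfl⟩ : ∃ m : ℕ, n = m + 1 := ⟨(n - 1).toNat, by omega⟩
    have h1 : Tendsto (fun z : ℂ => ∏ i, (z - w i) / (z - q * w i)) (cobounded ℂ)
        (𝓝 (∏ _i : Fin k, 1)) :=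
      tendsto_finsetProd _ fun i _ => tendsto_sub_div_sub_cobounded _ _
    have h2 : Tendsto (fun z : ℂ => ((1 - z)⁻¹) ^ (m + 1)) (cobounded ℂ) (𝓝 (0 ^ (m + 1))) :=
      (tendsto_inv₀_cobounded.comp (tendsto_const_sub_cobounded 1)).pow _
    have := h1.mul h2
    rw [zero_pow (Nat.succ_ne_zero m), mul_zero] at this
    refine this.congr fun z => ?_
    simp only [hgdef]
    congr 1
    rw [zpow_neg, inv_pow]
    norm_cast
  have := circleIntegral_sub_inv_mul_of_differentiableOn_exterior (a := 0) hR.1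
    (by simpa using hR.2) hdiff hlim
  rw [hg0] at this
  rw [← this]
  congr 1
  ext z
  simp only [hgdef, sub_zero]
  ring

theorem continuous_integrand_circleMap {k : ℕ} {q : ℝ} (hq : q ∈ Set.Ioo (0 : ℝ) 1)
    {r : Fin k → ℝ} (hr : ∀ j, r j ∈ Set.Ioo (0 : ℝ) 1)
    (hnest : ∀ A B : Fin k, A < B → q * r B + (1 - q) < r A) (n : Fin k → ℤ) :
    Continuous fun θ : Fin k → ℝ =>
      (∏ A : Fin k, ∏ B ∈ Finset.Ioi A,
        (circleMap 1 (r A) (θ A) - circleMap 1 (r B) (θ B)) /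
          (circleMap 1 (r A) (θ A) - (q : ℂ) * circleMap 1 (r B) (θ B))) *
        ∏ j : Fin k, (1 - circleMap 1 (r j) (θ j)) ^ (-(n j)) * (circleMap 1 (r j) (θ j))⁻¹ := by
  have hnorm : ∀ (j : Fin k) (t : ℝ), ‖circleMap 1 (r j) t - 1‖ = r j := fun j t => by
    simp [circleMap, abs_of_pos (hr j).1]
  refine Continuous.mul ?_ ?_
  · refine continuous_finsetProd _ fun A _ => continuous_finsetProd _ fun B hB => ?_
    refine Continuous.div (by fun_prop) (by fun_prop) fun θ h => ?_
    rw [sub_eq_zero] at h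
    have h1 := norm_mul_sub_one_le hq (circleMap 1 (r B) (θ B))
    rw [← h, hnorm, hnorm] at h1
    exact absurd (hnest A B (Finset.mem_Ioi.1 hB)) (not_lt.2 h1)
  · refine continuous_finsetProd _ fun j _ => Continuous.mul ?_ ?_
    · refine Continuous.zpow₀ (by fun_prop) _ fun θ => Or.inl fun h => ?_
      have h1 := hnorm j (θ j)
      rw [norm_sub_rev, h, norm_zero] at h1
      exact (hr j).1.ne h1
    · refine Continuous.inv₀ (by fun_prop) fun θ => ?_
      exact ne_zero_of_norm_sub_one_lt (by rw [hnorm]; exact (hr j).2)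

theorem iterInt_integrand_eq {k : ℕ} {q : ℝ} (hq : q ∈ Set.Ioo (0 : ℝ) 1)
    {r : Fin k → ℝ} (hr : ∀ j, r j ∈ Set.Ioo (0 : ℝ) 1)
    (hnest : ∀ A B : Fin k, A < B → q * r B + (1 - q) < r A)
    {n : Fin k → ℤ} (hpos : ∀ j, 1 ≤ n j) :
    iterInt k 1 r (fun z =>
      (∏ A : Fin k, ∏ B ∈ Finset.Ioi A, (z A - z B) / (z A - (q : ℂ) * z B))
        * ∏ j : Fin k, (1 - z j) ^ (-(n j)) * (z j)⁻¹) =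
      (-(2 * π * Complex.I)) ^ k * ((q : ℂ) ^ (k * (k - 1) / 2))⁻¹ := by
  induction k with
  | zero => simp [iterInt]
  | succ k ih =>
    have hcont := continuous_integrand_circleMap hq hr hnest n
    rw [iterInt, circleIntegral_iterInt_swap fun i => (hr _).1.le]
    · rw [iterInt_congr (g := fun w => -(2 * π * Complex.I * ((q : ℂ) ^ k)⁻¹) *
        ((∏ A : Fin k, ∏ B ∈ Finset.Ioi A, (w A - w B) / (w A - (q : ℂ) * w B))
          * ∏ j : Fin k, (1 - w j) ^ (-(n j.succ)) * (w j)⁻¹)) fun i => (hr _).1.le]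
      · rw [iterInt_const_mul, ih (fun j => hr _)
          (fun A B h => hnest _ _ (Fin.succ_lt_succ_iff.2 h)) (fun j => hpos _),
          Nat.triangle_succ, pow_add (q : ℂ), mul_inv, pow_succ _ k]
        ring
      · intro w hw
        have hw' : ∀ i, ‖w i - 1‖ = r i.succ := fun i => by simpa [dist_eq_norm] using hw i
        rw [← circleIntegral_prod_div_mul_zpow hq.1.ne' (hr 0) (w := w) (n := n 0) ?_ ?_ (hpos 0)]
        · rw [mul_comm, ← circleIntegral.integral_const_mul]
          congr 1
          ext z
          simp only [Fin.prod_univ_succ, Fin.cons_zero, Fin.cons_succ, Fin.Ioi_zero_eq_map,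
            Fin.Ioi_succ, Finset.prod_map, Fin.coe_succEmb]
          ring
        · intro i
          refine (norm_mul_sub_one_le hq _).trans_lt ?_
          rw [hw']
          exact hnest _ _ (Fin.succ_pos i)
        · exact fun i => ne_zero_of_norm_sub_one_lt (by rw [hw']; exact (hr _).2)
    · have hc : Continuous fun p : ℝ × (Fin k → ℝ) =>
          (Fin.cons p.1 p.2 : Fin (k + 1) → ℝ) := by fun_prop
      refine (hcont.comp hc).congr fun p => ?_
      have hcons : ∀ i : Fin (k + 1),
          circleMap 1 (r i) ((Fin.cons p.1 p.2 : Fin (k + 1) → ℝ) i) =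
            (Fin.cons (circleMap 1 (r 0) p.1) (fun i => circleMap 1 (r i.succ) (p.2 i)) :
              Fin (k + 1) → ℂ) i := fun i => by
        refine Fin.cases ?_ (fun j => ?_) i <;> simp
      simp only [Function.comp, hcons]

theorem stmt_14 (q : ℝ) (hq : q ∈ Set.Ioo (0:ℝ) 1) (k : ℕ) (hk : 1 ≤ k)
    (r : Fin k → ℝ) (hr : ∀ j, r j ∈ Set.Ioo (0:ℝ) 1)
    (hnest : ∀ A B : Fin k, A < B → q * r B + (1 - q) < r A)
    (n : Fin k → ℤ) (hmono : Antitone n) (hpos : ∀ j, 1 ≤ n j) :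
    ((-1 : ℂ)) ^ k * (q : ℂ) ^ (k * (k - 1) / 2) / (2 * (π : ℂ) * Complex.I) ^ k
      * iterInt k 1 r (fun z =>
          (∏ A : Fin k, ∏ B ∈ Finset.Ioi A, (z A - z B) / (z A - (q : ℂ) * z B))
            * ∏ j : Fin k, (1 - z j) ^ (-(n j)) * (z j)⁻¹) = 1 := by
  have hq0 : (q : ℂ) ≠ 0 := by exact_mod_cast hq.1.ne'
  have hπ : (π : ℂ) ≠ 0 := by exact_mod_cast Real.pi_ne_zero
  have hI := Complex.I_ne_zero
  rw [iterInt_integrand_eq hq hr hnest hpos, neg_pow (2 * (π : ℂ) * Complex.I)]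
  have h1 : ((-1 : ℂ)) ^ k * (-1) ^ k = 1 := by rw [← mul_pow]; simp
  have h2 : (2 * (π : ℂ) * Complex.I) ^ k ≠ 0 := pow_ne_zero _ (by simp [hπ])
  have h3 : (q : ℂ) ^ (k * (k - 1) / 2) ≠ 0 := pow_ne_zero _ hq0
  generalize (2 * (π : ℂ) * Complex.I) ^ k = x at *
  generalize (q : ℂ) ^ (k * (k - 1) / 2) = y at *
  field_simp
  linear_combination h1
end

section
/- (Commutation relation for the first Macdonald difference operator at t = 0.) Fix q ∈ (0,1), integers N ≥ 1, 1 ≤ n ≤ N and k ≥ 1. Let x ∈ ℂ^N satisfy q^a x_i ≠ q^b x_j for all 1 ≤ i < j ≤ N and all integers 0 ≤ a, b ≤ k (so every application of the operators below is well defined along the way). Then for every function F : ℂ^N → ℂ: ((D_n)^k (p·F))(x) − p(x) · ((D_n)^k F)(x) = (1 − q^k) x_n · ((D_{n−1} − D_n)(D_n)^{k−1} F)(x), where p(x) = x_1 + ⋯ + x_n and (p·F)(x) = p(x) F(x). -/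
/-- The `t = 0` Macdonald first difference operator
`(D_n F)(x) = ∑_{i=1}^{n} (∏_{j≤n, j≠i} (-x_j)/(x_i - x_j)) F(x_1,…,q x_i,…,x_N)`;
`n = 0` gives the zero operator. -/
noncomputable def Dop {N : ℕ} (q : ℝ) (n : ℕ) (F : (Fin N → ℂ) → ℂ) (x : Fin N → ℂ) : ℂ :=
  ∑ i ∈ Finset.univ.filter (fun i : Fin N => (i : ℕ) < n),
    (∏ j ∈ Finset.univ.filter (fun j : Fin N => (j : ℕ) < n ∧ j ≠ i), (-(x j)) / (x i - x j))
      * F (Function.update x i ((q : ℂ) * x i))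

section MacdonaldDifference

variable {N : ℕ}

/-- The coefficient `∏_{j ∈ s, j ≠ i} (-x_j)/(x_i - x_j)` of the difference operator. -/
noncomputable def dopCoeff (s : Finset (Fin N)) (x : Fin N → ℂ) (i : Fin N) : ℂ :=
  ∏ j ∈ s.erase i, (-(x j)) / (x i - x j)

/-- The set of the first `n` indices. -/
def firstIndices (N n : ℕ) : Finset (Fin N) :=
  Finset.univ.filter (fun i : Fin N => (i : ℕ) < n)

/-- The difference operator with an additional factor `x_i` in each summand. -/
noncomputable def weightedDop (q : ℝ) (n : ℕ) (F : (Fin N → ℂ) → ℂ) (x : Fin N → ℂ) : ℂ :=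
  ∑ i ∈ firstIndices N n,
    dopCoeff (firstIndices N n) x i * (x i * F (Function.update x i ((q : ℂ) * x i)))

/-- No two coordinates become equal after multiplication by powers of `q` up to `q ^ k`. -/
def QSeparated (q : ℝ) (k : ℕ) (x : Fin N → ℂ) : Prop :=
  ∀ i j : Fin N, i ≠ j → ∀ A B : ℕ, A ≤ k → B ≤ k → (q : ℂ) ^ A * x i ≠ (q : ℂ) ^ B * x j

lemma Dop_eq_sum_dopCoeff (q : ℝ) (n : ℕ) (F : (Fin N → ℂ) → ℂ) (x : Fin N → ℂ) :
    Dop q n F x = ∑ i ∈ firstIndices N n,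
      dopCoeff (firstIndices N n) x i * F (Function.update x i ((q : ℂ) * x i)) := by
  unfold Dop dopCoeff firstIndices
  refine Finset.sum_congr rfl fun i _ => ?_
  congr 2
  ext j
  simp [and_comm]

lemma QSeparated.update {q : ℝ} {k : ℕ} {x : Fin N → ℂ} (h : QSeparated q (k + 1) x)
    (i : Fin N) : QSeparated q k (Function.update x i ((q : ℂ) * x i)) := by
  intro a b hab A B hA hB
  rcases eq_or_ne a i with rfl | ha
  · rw [Function.update_self, Function.update_of_ne hab.symm, ← mul_assoc, ← pow_succ]
    exact h a b hab _ _ (by omega) (by omega)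
  · rw [Function.update_of_ne ha]
    rcases eq_or_ne b i with rfl | hb
    · rw [Function.update_self, ← mul_assoc, ← pow_succ]
      exact h a b hab _ _ (by omega) (by omega)
    · rw [Function.update_of_ne hb]
      exact h a b hab _ _ (by omega) (by omega)

lemma dopCoeff_mul_dopCoeff_update {s : Finset (Fin N)} {c : ℂ} {x : Fin N → ℂ} {i j : Fin N}
    (hi : i ∈ s) (hj : j ∈ s) (hij : i ≠ j) (hx : x j - c * x i ≠ 0) :
    dopCoeff s x i * dopCoeff s (Function.update x i (c * x i)) j * (x j - c * x i) =
      c * x i * x j / (x i - x j) *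
        ((∏ l ∈ (s.erase i).erase j, (-(x l)) / (x i - x l)) *
          ∏ l ∈ (s.erase i).erase j, (-(x l)) / (x j - x l)) := by
  have h₁ : dopCoeff s x i = (-(x j)) / (x i - x j) *
      ∏ l ∈ (s.erase i).erase j, (-(x l)) / (x i - x l) :=
    (Finset.mul_prod_erase _ _ (Finset.mem_erase.2 ⟨hij.symm, hj⟩)).symm
  have h₂ : dopCoeff s (Function.update x i (c * x i)) j = (-(c * x i)) / (x j - c * x i) *
      ∏ l ∈ (s.erase i).erase j, (-(x l)) / (x j - x l) := by
    unfold dopCoeff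
    rw [← Finset.mul_prod_erase _ _ (Finset.mem_erase.2 ⟨hij, hi⟩), Function.update_self,
      Function.update_of_ne hij.symm, Finset.erase_right_comm]
    congr 1
    refine Finset.prod_congr rfl fun l hl => ?_
    rw [Function.update_of_ne (Finset.mem_erase.1 (Finset.mem_erase.1 hl).2).1]
  have h₃ : (-(c * x i)) / (x j - c * x i) * (x j - c * x i) = -(c * x i) :=
    div_mul_cancel₀ _ hx
  rw [h₁, h₂]
  linear_combination (-(x j)) / (x i - x j) *
    (∏ l ∈ (s.erase i).erase j, (-(x l)) / (x i - x l)) *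
    (∏ l ∈ (s.erase i).erase j, (-(x l)) / (x j - x l)) * h₃

/-- The plain and the weighted difference operators `q`-commute. -/
lemma Dop_weightedDop {q : ℝ} (n : ℕ) (F : (Fin N → ℂ) → ℂ) {x : Fin N → ℂ}
    (hx : QSeparated q 1 x) :
    Dop q n (weightedDop q n F) x = q * weightedDop q n (Dop q n F) x := by
  set s := firstIndices N n with hs
  let g : Fin N → Fin N → ℂ := fun i j =>
    dopCoeff s x i * dopCoeff s (Function.update x i (q * x i)) j *
      (Function.update x i (q * x i) j - q * x i) *
      F (Function.update (Function.update x i (q * x i)) j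
        (q * Function.update x i (q * x i) j))
  have hdiff : Dop q n (weightedDop q n F) x - q * weightedDop q n (Dop q n F) x =
      ∑ i ∈ s, ∑ j ∈ s, g i j := by
    rw [Dop_eq_sum_dopCoeff]
    simp only [weightedDop, Dop_eq_sum_dopCoeff, ← hs, Finset.mul_sum]
    rw [← Finset.sum_sub_distrib]
    refine Finset.sum_congr rfl fun i _ => ?_
    rw [← Finset.sum_sub_distrib]
    refine Finset.sum_congr rfl fun j _ => ?_
    simp only [g]
    ring
  have hanti : ∀ i ∈ s, ∀ j ∈ s, g i j = -g j i := by
    intro i hi j hj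
    rcases eq_or_ne i j with rfl | hij
    · simp [g]
    · have hne : ∀ a b : Fin N, a ≠ b → x b - q * x a ≠ 0 := fun a b hab h =>
        hx a b hab 1 0 le_rfl zero_le_one (by linear_combination -h)
      simp only [g, Function.update_of_ne hij, Function.update_of_ne hij.symm]
      rw [dopCoeff_mul_dopCoeff_update hi hj hij (hne i j hij),
        dopCoeff_mul_dopCoeff_update hj hi hij.symm (hne j i hij.symm),
        Function.update_comm hij, Finset.erase_right_comm (a := j) (b := i),
        ← neg_sub (x i) (x j), div_neg]
      ring
  have hneg : ∑ i ∈ s, ∑ j ∈ s, g i j = -∑ i ∈ s, ∑ j ∈ s, g i j := by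
    conv_lhs => rw [Finset.sum_comm]
    simp only [← Finset.sum_neg_distrib]
    exact Finset.sum_congr rfl fun i hi => Finset.sum_congr rfl fun j hj => hanti j hj i hi
  exact sub_eq_zero.1 (hdiff.trans (self_eq_neg.1 hneg))

lemma sum_update_mul {s : Finset (Fin N)} (c : ℂ) (x : Fin N → ℂ) {i : Fin N} (hi : i ∈ s) :
    ∑ j ∈ s, Function.update x i (c * x i) j = ∑ j ∈ s, x j + (c - 1) * x i := by
  rw [Finset.sum_update_of_mem hi, ← Finset.add_sum_erase s x hi, Finset.sdiff_singleton_eq_erase]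
  ring

lemma Dop_sum_mul_sub (q : ℝ) (n : ℕ) (F H : (Fin N → ℂ) → ℂ) (c : ℂ) (x : Fin N → ℂ) :
    Dop q n (fun w => (∑ i ∈ firstIndices N n, w i) * F w - c * H w) x =
      (∑ i ∈ firstIndices N n, x i) * Dop q n F x + (q - 1) * weightedDop q n F x
        - c * Dop q n H x := by
  simp only [Dop_eq_sum_dopCoeff, weightedDop]
  rw [Finset.mul_sum, Finset.mul_sum, Finset.mul_sum, ← Finset.sum_add_distrib,
    ← Finset.sum_sub_distrib]
  refine Finset.sum_congr rfl fun i hi => ?_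
  rw [sum_update_mul _ _ hi]
  ring

lemma Dop_iterate_sum_mul {q : ℝ} (n k : ℕ) (F : (Fin N → ℂ) → ℂ) {x : Fin N → ℂ}
    (hx : QSeparated q (k + 1) x) :
    (Dop q n)^[k + 1] (fun w => (∑ i ∈ firstIndices N n, w i) * F w) x =
      (∑ i ∈ firstIndices N n, x i) * (Dop q n)^[k + 1] F x
        - (1 - (q : ℂ) ^ (k + 1)) * weightedDop q n ((Dop q n)^[k] F) x := by
  induction k generalizing x with
  | zero =>
    have h := Dop_sum_mul_sub q n F 0 0 x
    simp only [zero_mul, sub_zero] at h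
    simp only [zero_add, Function.iterate_one, Function.iterate_zero, id_eq, pow_one, h]
    ring
  | succ k ih =>
    have hstep : Dop q n ((Dop q n)^[k + 1]
          (fun w => (∑ i ∈ firstIndices N n, w i) * F w)) x =
        Dop q n (fun w => (∑ i ∈ firstIndices N n, w i) * (Dop q n)^[k + 1] F w
          - (1 - (q : ℂ) ^ (k + 1)) * weightedDop q n ((Dop q n)^[k] F) w) x := by
      simp only [Dop_eq_sum_dopCoeff q n _ x]
      exact Finset.sum_congr rfl fun i _ => by rw [ih (hx.update i)]
    have hx1 : QSeparated q 1 x := fun i j hij A B hA hB =>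
      hx i j hij A B (by omega) (by omega)
    rw [Function.iterate_succ_apply', hstep, Dop_sum_mul_sub, Dop_weightedDop n _ hx1,
      ← Function.iterate_succ_apply' (Dop q n) k F,
      ← Function.iterate_succ_apply' (Dop q n) (k + 1) F]
    ring

lemma mul_Dop_sub_Dop_succ (q : ℝ) {n : ℕ} (hn : n < N) (F : (Fin N → ℂ) → ℂ)
    {x : Fin N → ℂ} (hx : ∀ i : Fin N, (i : ℕ) < n → x i ≠ x ⟨n, hn⟩) :
    x ⟨n, hn⟩ * (Dop q n F x - Dop q (n + 1) F x) = -weightedDop q (n + 1) F x := by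
  set m : Fin N := ⟨n, hn⟩ with hm
  have hmem : m ∉ firstIndices N n := by simp [firstIndices, hm]
  have hins : firstIndices N (n + 1) = insert m (firstIndices N n) := by
    ext i
    simp only [firstIndices, Finset.mem_filter, Finset.mem_univ, true_and, Finset.mem_insert,
      hm, Fin.ext_iff]
    omega
  simp only [Dop_eq_sum_dopCoeff, weightedDop]
  rw [hins, Finset.sum_insert hmem, Finset.sum_insert hmem]
  have key : x m * ∑ i ∈ firstIndices N n, dopCoeff (firstIndices N n) x i *
        F (Function.update x i (q * x i)) =
      ∑ i ∈ firstIndices N n, (x m - x i) * (dopCoeff (insert m (firstIndices N n)) x i *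
        F (Function.update x i (q * x i))) := by
    rw [Finset.mul_sum]
    refine Finset.sum_congr rfl fun i hi => ?_
    have hne : m ≠ i := fun h => hmem (h ▸ hi)
    have hxi : x i - x m ≠ 0 := sub_ne_zero.2 (hx i (by simpa [firstIndices] using hi))
    have hc : dopCoeff (insert m (firstIndices N n)) x i =
        (-(x m)) / (x i - x m) * dopCoeff (firstIndices N n) x i := by
      unfold dopCoeff
      rw [Finset.erase_insert_of_ne hne,
        Finset.prod_insert fun h => hmem (Finset.mem_of_mem_erase h)]
    rw [hc]
    field_simp
    ring
  have hsplit : ∑ i ∈ firstIndices N n, (x m - x i) *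
        (dopCoeff (insert m (firstIndices N n)) x i * F (Function.update x i (q * x i))) =
      x m * ∑ i ∈ firstIndices N n, dopCoeff (insert m (firstIndices N n)) x i *
          F (Function.update x i (q * x i)) -
        ∑ i ∈ firstIndices N n, dopCoeff (insert m (firstIndices N n)) x i *
          (x i * F (Function.update x i (q * x i))) := by
    rw [Finset.mul_sum, ← Finset.sum_sub_distrib]
    exact Finset.sum_congr rfl fun i _ => by ring
  linear_combination key.trans hsplit

end MacdonaldDifference

theorem stmt_15 (q : ℝ) (hq : q ∈ Set.Ioo (0:ℝ) 1) (N : ℕ) (hN : 1 ≤ N)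
    (n : ℕ) (hn1 : 1 ≤ n) (hnN : n ≤ N) (k : ℕ) (hk : 1 ≤ k)
    (x : Fin N → ℂ)
    (hx : ∀ i j : Fin N, i < j → ∀ A B : ℕ, A ≤ k → B ≤ k →
      (q : ℂ) ^ A * x i ≠ (q : ℂ) ^ B * x j)
    (F : (Fin N → ℂ) → ℂ) :
    ((Dop q n)^[k]
        (fun w => (∑ i ∈ Finset.univ.filter (fun i : Fin N => (i : ℕ) < n), w i) * F w)) x
      - (∑ i ∈ Finset.univ.filter (fun i : Fin N => (i : ℕ) < n), x i) * ((Dop q n)^[k] F) x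
    = (1 - (q : ℂ) ^ k) * x ⟨n - 1, by omega⟩
        * (Dop q (n - 1) ((Dop q n)^[k - 1] F) x - Dop q n ((Dop q n)^[k - 1] F) x) := by
  obtain ⟨k, rfl⟩ : ∃ l, k = l + 1 := ⟨k - 1, by omega⟩
  obtain ⟨n, rfl⟩ : ∃ m, n = m + 1 := ⟨n - 1, by omega⟩
  have hsep : QSeparated q (k + 1) x := by
    intro i j hij A B hA hB
    rcases lt_or_gt_of_ne hij with h | h
    · exact hx i j h A B hA hB
    · exact (hx j i h B A hB hA).symm
  have hlast : ∀ i : Fin N, (i : ℕ) < n → x i ≠ x ⟨n, by omega⟩ := fun i hi h =>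
    hx i ⟨n, by omega⟩ hi 0 0 (by omega) (by omega) (by rw [h])
  have hcomm := Dop_iterate_sum_mul (n + 1) k F hsep
  have hdiff := mul_Dop_sub_Dop_succ q (by omega) ((Dop q (n + 1))^[k] F) hlast
  simp only [firstIndices] at hcomm
  simp only [Nat.add_sub_cancel]
  rw [hcomm]
  linear_combination -(1 - (q : ℂ) ^ (k + 1)) * hdiff
end
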